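/- arXiv:1508.05639 — 2 statements merged into one kernel-verified Lean document; each statement's English description precedes it below -/
import Mathlib

section
/- If S is a Λ-Carleson family in a dyadic lattice D and m ≥ 2 is an integer, then S can be written as a union of m families S_1, ..., S_m, each of which is (1 + (Λ−1)/m)-Carleson. -/
open MeasureTheory Set
open scoped ENNReal Classical

structure Cube (n : ℕ) where
  corner : Fin n → ℝ
  side : ℝ
  side_pos : 0 < side

namespace Cube

def toSet {n : ℕ} (Q : Cube n) : Set (Fin n → ℝ) :=
  {y | ∀ i, Q.corner i ≤ y i ∧ y i < Q.corner i + Q.side}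

/-- `Q'` is one of the `2^n` dyadic children of `Q`. -/
def IsChild {n : ℕ} (Q' Q : Cube n) : Prop :=
  Q'.side = Q.side / 2 ∧ ∃ ε : Fin n → Bool,
    Q'.corner = fun i => Q.corner i + (if ε i then Q.side / 2 else 0)

/-- `Q' ∈ 𝒟(Q)`: `Q'` is obtained from `Q` by iteratively taking dyadic children. -/
def IsDescendant {n : ℕ} (Q' Q : Cube n) : Prop :=
  Relation.ReflTransGen IsChild Q' Q

end Cube

/-- The three dyadic lattice axioms (DL-1), (DL-2), (DL-3). -/
def IsDyadicLattice {n : ℕ} (D : Set (Cube n)) : Prop :=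
  (∀ Q ∈ D, ∀ Q' : Cube n, Q'.IsChild Q → Q' ∈ D) ∧
  (∀ Q ∈ D, ∀ Q' ∈ D, ∃ P ∈ D, Q.IsDescendant P ∧ Q'.IsDescendant P) ∧
  (∀ K : Set (Fin n → ℝ), IsCompact K → ∃ Q ∈ D, K ⊆ Q.toSet)

/-- `S` is a `Λ`-Carleson family relative to the lattice `D`. -/
def IsCarleson {n : ℕ} (Λ : ℝ) (D S : Set (Cube n)) : Prop :=
  ∀ Q ∈ D, (∑' P : {P : Cube n // P ∈ S ∧ P.toSet ⊆ Q.toSet}, volume P.1.toSet)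
    ≤ ENNReal.ofReal Λ * volume Q.toSet

/-- `S` is an `η`-sparse family. -/
def IsSparse {n : ℕ} (η : ℝ) (S : Set (Cube n)) : Prop :=
  ∃ E : Cube n → Set (Fin n → ℝ),
    (∀ Q ∈ S, E Q ⊆ Q.toSet ∧ MeasurableSet (E Q) ∧
      ENNReal.ofReal η * volume Q.toSet ≤ volume (E Q)) ∧
    S.PairwiseDisjoint E


namespace CS

variable {n : ℕ}

lemma child_subset {P Q : Cube n} (h : P.IsChild Q) : P.toSet ⊆ Q.toSet := by
  obtain ⟨hs, ε, hc⟩ := h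
  intro x hx i
  have h1 := hx i
  have h2 := Q.side_pos
  rw [hs, hc] at h1
  dsimp only at h1
  split_ifs at h1 <;> constructor <;> linarith

lemma child_unique {P P' Q : Cube n} (h : P.IsChild Q) (h' : P'.IsChild Q)
    {x : Fin n → ℝ} (hx : x ∈ P.toSet) (hx' : x ∈ P'.toSet) : P = P' := by
  obtain ⟨hs, ε, hc⟩ := h
  obtain ⟨hs', ε', hc'⟩ := h'
  have h2 := Q.side_pos
  have : P.corner = P'.corner := by
    funext i
    have h1 := hx i
    have h1' := hx' i
    rw [hs, hc] at h1
    rw [hs', hc'] at h1'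
    rw [hc, hc']
    dsimp only at h1 h1' ⊢
    split_ifs at h1 h1' ⊢ <;> linarith
  cases P; cases P'
  simp only at hs hs' this
  subst this
  simp [hs, hs']

lemma desc_subset {P Q : Cube n} (h : P.IsDescendant Q) : P.toSet ⊆ Q.toSet := by
  induction h with
  | refl => exact subset_rfl
  | tail _ h ih => exact ih.trans (child_subset h)

lemma desc_side {P Q : Cube n} (h : P.IsDescendant Q) : P.side < Q.side ∨ P = Q := by
  induction h with
  | refl => exact Or.inr rfl
  | @tail b c _ h ih =>
    left
    have h1 := h.1
    have h2 := c.side_pos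
    rcases ih with ih | rfl <;> linarith

lemma desc_antisymm {P Q : Cube n} (h : P.IsDescendant Q) (h' : Q.IsDescendant P) : P = Q := by
  rcases desc_side h with h1 | h1
  · rcases desc_side h' with h2 | h2
    · linarith
    · exact h2.symm
  · exact h1

lemma corner_mem (P : Cube n) : P.corner ∈ P.toSet := fun i => ⟨le_rfl, by have := P.side_pos; linarith⟩

lemma nested_aux {P A : Cube n} {x : Fin n → ℝ} (h : P.IsDescendant A) (hx : x ∈ P.toSet) :
    Relation.ReflTransGen (fun A C : Cube n => C.IsChild A ∧ x ∈ C.toSet) A P := by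
  induction h using Relation.ReflTransGen.head_induction_on with
  | refl => exact .refl
  | head h _ ih => exact (ih (child_subset h hx)).tail ⟨h, hx⟩

lemma nested_aux2 {P A : Cube n} {x : Fin n → ℝ} 
    (h : Relation.ReflTransGen (fun A C : Cube n => C.IsChild A ∧ x ∈ C.toSet) A P) :
    P.IsDescendant A := by
  induction h with
  | refl => exact .refl
  | tail _ h ih => exact Relation.ReflTransGen.head h.1 ih

lemma nested {D : Set (Cube n)} (hD : IsDyadicLattice D) {P Q : Cube n} (hP : P ∈ D) (hQ : Q ∈ D)
    {x : Fin n → ℝ} (hx : x ∈ P.toSet) (hx' : x ∈ Q.toSet) :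
    P.IsDescendant Q ∨ Q.IsDescendant P := by
  obtain ⟨A, _, h1, h2⟩ := hD.2.1 P hP Q hQ
  have U : Relator.RightUnique (fun A C : Cube n => C.IsChild A ∧ x ∈ C.toSet) :=
    fun a b c hb hc => child_unique hb.1 hc.1 hb.2 hc.2
  rcases Relation.ReflTransGen.total_of_right_unique U (nested_aux h1 hx) (nested_aux h2 hx') with h | h
  · exact Or.inr (nested_aux2 h)
  · exact Or.inl (nested_aux2 h)

lemma finite_interval {P A : Cube n} (h : P.IsDescendant A) :
    {R : Cube n | P.IsDescendant R ∧ R.IsDescendant A}.Finite := by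
  induction h with
  | refl =>
    refine (Set.finite_singleton P).subset ?_
    rintro R ⟨h1, h2⟩
    exact desc_antisymm h2 h1
  | @tail B A hB h ih =>
    refine (ih.insert A).subset ?_
    rintro R ⟨h1, h2⟩
    rcases Relation.ReflTransGen.cases_tail h2 with h3 | ⟨C, h3, h4⟩
    · left; exact h3.symm
    · right
      have hx := corner_mem P
      have : C = B := child_unique h4 h (desc_subset h3 (desc_subset h1 hx)) (desc_subset hB hx)
      subst this
      exact ⟨h1, h3⟩

def U (S : Set (Cube n)) (P Q : Cube n) : Set (Cube n) :=
  {R | R ∈ S ∧ P.IsDescendant R ∧ ¬ Q.IsDescendant R}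

noncomputable def lev (S : Set (Cube n)) (Q P : Cube n) : ℤ := (U S P Q).ncard - (U S Q P).ncard


lemma U_fin {D S : Set (Cube n)} (hD : IsDyadicLattice D) (hS : S ⊆ D)
    {P A : Cube n} (hA : A ∈ D) (h : P.IsDescendant A) : (U S P A).Finite := by
  refine (finite_interval h).subset ?_
  rintro R ⟨h1, h2, h3⟩
  refine ⟨h2, ?_⟩
  have hx := corner_mem P
  rcases nested hD (hS h1) hA (desc_subset h2 hx) (desc_subset h hx) with h4 | h4
  · exact h4
  · exact absurd h4 h3

lemma U_diff {S : Set (Cube n)} {P Q A : Cube n} (hQ : Q.IsDescendant A) : U S P A \ U S Q A = U S P Q := by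
  ext R
  have : A.IsDescendant R → Q.IsDescendant R := fun h => hQ.trans h
  simp only [U, Set.mem_sdiff, Set.mem_ofPred_eq]
  tauto

lemma lev_eq {D S : Set (Cube n)} (hD : IsDyadicLattice D) (hS : S ⊆ D)
    {P Q A : Cube n} (hA : A ∈ D) (hP : P.IsDescendant A) (hQ : Q.IsDescendant A) :
    lev S Q P = (U S P A).ncard - (U S Q A).ncard := by
  have h1 := Set.ncard_inter_add_ncard_sdiff_eq_ncard (U S P A) (U S Q A) (U_fin hD hS hA hP)
  have h2 := Set.ncard_inter_add_ncard_sdiff_eq_ncard (U S Q A) (U S P A) (U_fin hD hS hA hQ)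
  rw [U_diff hQ] at h1
  rw [U_diff hP, Set.inter_comm] at h2
  unfold lev
  omega

lemma lev_sub {D S : Set (Cube n)} (hD : IsDyadicLattice D) (hS : S ⊆ D)
    {P Q Q0 : Cube n} (hQ0 : Q0 ∈ D) (hQ : Q ∈ D) (h : P.IsDescendant Q) :
    lev S Q0 P - lev S Q0 Q = (U S P Q).ncard := by
  obtain ⟨A, hA, h1, h2⟩ := hD.2.1 Q hQ Q0 hQ0
  have hP : P.IsDescendant A := h.trans h1
  rw [lev_eq hD hS hA hP h2, lev_eq hD hS hA h1 h2]
  have h3 := Set.ncard_inter_add_ncard_sdiff_eq_ncard (U S P A) (U S Q A) (U_fin hD hS hA hP)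
  rw [U_diff h1] at h3
  have : U S P A ∩ U S Q A = U S Q A := by
    apply Set.inter_eq_right.2
    rintro R ⟨a, b, c⟩
    exact ⟨a, h.trans b, c⟩
  rw [this] at h3
  omega

lemma lev_lt {D S : Set (Cube n)} (hD : IsDyadicLattice D) (hS : S ⊆ D)
    {P Q Q0 : Cube n} (hQ0 : Q0 ∈ D) (hP : P ∈ S) (hQ : Q ∈ D) (h : P.IsDescendant Q)
    (hne : P ≠ Q) : lev S Q0 Q < lev S Q0 P := by
  have h1 := lev_sub hD hS hQ0 hQ h
  have h2 : 0 < (U S P Q).ncard := by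
    rw [Set.ncard_pos (U_fin hD hS hQ h)]
    exact ⟨P, hP, .refl, fun h' => hne (desc_antisymm h h')⟩
  omega

lemma count {D S : Set (Cube n)} (hD : IsDyadicLattice D) (hS : S ⊆ D)
    {Q0 Q : Cube n} (hQ0 : Q0 ∈ D) (m : ℕ) (hm : 2 ≤ m) (i : ℤ) (x : Fin n → ℝ) 
    (F : Set (Cube n)) (hF : F = {P | (P ∈ S ∧ P.toSet ⊆ Q.toSet) ∧ x ∈ P.toSet})
    (hfin : F.Finite) :
    m * {P | P ∈ F ∧ lev S Q0 P % m = i}.ncard ≤ F.ncard + (m - 1) := by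
  rcases F.eq_empty_or_nonempty with h0 | hne
  · simp [h0]
  obtain ⟨P, hP, hPmax⟩ := Set.exists_max_image F (lev S Q0) hfin hne
  obtain ⟨R, hR, hRmin⟩ := Set.exists_min_image F (lev S Q0) hfin hne
  have memF : ∀ {A}, A ∈ F → (A ∈ S ∧ A.toSet ⊆ Q.toSet) ∧ x ∈ A.toSet := by
    intro A hA; rw [hF] at hA; exact hA
  have inj : Set.InjOn (lev S Q0) F := by
    intro A hA B hB hAB
    by_contra hne
    have hA' := memF hA
    have hB' := memF hB
    rcases nested hD (hS hA'.1.1) (hS hB'.1.1) hA'.2 hB'.2 with h | h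
    · exact (lev_lt hD hS hQ0 hA'.1.1 (hS hB'.1.1) h hne).ne hAB.symm
    · exact (lev_lt hD hS hQ0 hB'.1.1 (hS hA'.1.1) h (Ne.symm hne)).ne hAB
  have hP' := memF hP
  have hR' := memF hR
  have hPR : P.IsDescendant R := by
    rcases nested hD (hS hP'.1.1) (hS hR'.1.1) hP'.2 hR'.2 with h | h
    · exact h
    · by_cases e : R = P
      · rw [e]; exact .refl
      · have := lev_lt hD hS hQ0 hR'.1.1 (hS hP'.1.1) h e
        have := hPmax R hR
        omega
  have hsub := lev_sub hD hS hQ0 (hS hR'.1.1) hPR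
  have hN : (U S P R).ncard + 1 ≤ F.ncard := by
    have hnot : R ∉ U S P R := fun h => h.2.2 .refl
    rw [← Set.ncard_insert_of_notMem hnot (U_fin hD hS (hS hR'.1.1) hPR)]
    apply Set.ncard_le_ncard _ hfin
    rintro A (rfl | ⟨h1, h2, h3⟩)
    · exact hR
    · have hxA := desc_subset h2 hP'.2
      rw [hF]
      refine ⟨⟨h1, ?_⟩, hxA⟩
      rcases nested hD (hS h1) (hS hR'.1.1) hxA hR'.2 with h | h
      · exact (desc_subset h).trans hR'.1.2
      · exact absurd h h3
  set G := {P | P ∈ F ∧ lev S Q0 P % m = i} with hG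
  have hGfin : G.Finite := hfin.subset fun A h => h.1
  have key : (hGfin.toFinset ×ˢ Finset.range m).card ≤
      (Finset.Ico (lev S Q0 R) (lev S Q0 P + m)).card := by
    apply Finset.card_le_card_of_injOn (fun p => lev S Q0 p.1 + (p.2 : ℤ))
    · rintro ⟨A, j⟩ h
      simp only [Finset.coe_product, Set.mem_prod, Finset.mem_coe, Set.Finite.mem_toFinset,
        Finset.mem_range] at h
      have h1 := hPmax A h.1.1
      have h2 := hRmin A h.1.1
      simp only [Finset.coe_Ico, Set.mem_Ico]
      omega
    · rintro ⟨A, j⟩ h ⟨B, k⟩ h' e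
      simp only [Finset.coe_product, Set.mem_prod, Finset.mem_coe, Set.Finite.mem_toFinset,
        Finset.mem_range] at h h'
      dsimp only at e
      have e1 : (j : ℤ) = k := by
        have a1 := h.1.2
        have a2 := h'.1.2
        have a3 : (lev S Q0 A - lev S Q0 B) % m = 0 := by
          rw [Int.sub_emod, a1, a2]; simp
        have a4 : ((k : ℤ) - j) % m = 0 := by
          rw [← a3]; congr 1; omega
        have a5 := Int.eq_zero_of_abs_lt_dvd (Int.dvd_of_emod_eq_zero a4)
          (by rw [abs_lt]; omega)
        omega
      have e2 : lev S Q0 A = lev S Q0 B := by omega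
      have e3 := inj h.1.1 h'.1.1 e2
      simp only [Prod.mk.injEq]
      exact ⟨e3, by exact_mod_cast e1⟩
  rw [Finset.card_product, Finset.card_range, Int.card_Ico,
    ← Set.ncard_eq_toFinset_card G hGfin, mul_comm] at key
  omega


lemma toSet_eq (P : Cube n) : P.toSet = Set.pi univ fun i => Ico (P.corner i) (P.corner i + P.side) := by
  ext x; simp [Cube.toSet, Set.mem_pi]

lemma meas (P : Cube n) : MeasurableSet P.toSet := by
  rw [toSet_eq]; exact MeasurableSet.univ_pi fun i => measurableSet_Ico

lemma vol (P : Cube n) : volume P.toSet = ENNReal.ofReal P.side ^ n := by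
  rw [toSet_eq, volume_pi_pi]; simp

lemma vol_ne_zero (P : Cube n) : volume P.toSet ≠ 0 := by
  rw [vol]; exact pow_ne_zero _ (by simpa using P.side_pos)

lemma vol_ne_top (P : Cube n) : volume P.toSet ≠ ⊤ := by
  rw [vol]; exact ENNReal.pow_ne_top ENNReal.ofReal_ne_top

lemma tsum_vol (p : Cube n → Prop) (hc : Countable {P : Cube n // p P}) :
    ∑' P : {P : Cube n // p P}, volume P.1.toSet
      = ∫⁻ x, (({P | p P ∧ x ∈ P.toSet}.encard : ℕ∞) : ℝ≥0∞) := by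
  have : ∀ P : {P : Cube n // p P}, volume P.1.toSet = ∫⁻ x, P.1.toSet.indicator 1 x := by
    intro P; rw [lintegral_indicator_one (meas _)]
  simp_rw [this]
  rw [← lintegral_tsum]
  · congr 1
    funext x
    rw [← ENNReal.tsum_set_one]
    rw [tsum_subtype {P | p P ∧ x ∈ P.toSet} (fun _ => (1 : ℝ≥0∞))]
    change ∑' P : ({P | p P} : Set (Cube n)), _ = _
    rw [tsum_subtype {P | p P} (fun P => P.toSet.indicator (1 : (Fin n → ℝ) → ℝ≥0∞) x)]
    congr 1
    funext P
    simp only [Set.indicator, Set.mem_ofPred_eq, Pi.one_apply]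
    split_ifs <;> first | rfl | tauto
  · intro P
    exact (measurable_one.indicator (meas _)).aemeasurable

end CS

open CS

theorem carleson_splitting {n : ℕ} (D S : Set (Cube n))
    (hD : IsDyadicLattice D) (hS : S ⊆ D) (Λ : ℝ) (hΛ : 1 < Λ)
    (hcar : IsCarleson Λ D S) (m : ℕ) (hm : 2 ≤ m) :
    ∃ T : Fin m → Set (Cube n), S = ⋃ i, T i ∧
      ∀ i, IsCarleson (1 + (Λ - 1) / m) D (T i) := by
  obtain ⟨Q0, hQ0, -⟩ := hD.2.2 ∅ isCompact_empty
  have hm0 : (0 : ℤ) < m := by omega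
  refine ⟨fun i => {P | P ∈ S ∧ lev S Q0 P % m = (i : ℕ)}, ?_, ?_⟩
  · ext P
    simp only [Set.mem_iUnion, Set.mem_ofPred_eq]
    refine ⟨fun h => ?_, fun ⟨i, h⟩ => h.1⟩
    have h1 := Int.emod_nonneg (lev S Q0 P) hm0.ne'
    have h2 := Int.emod_lt_of_pos (lev S Q0 P) hm0
    exact ⟨⟨(lev S Q0 P % m).toNat, by omega⟩, h, by simp [h1]⟩
  · intro i Q hQ
    have hsum := hcar Q hQ
    have hc : Countable {P : Cube n // P ∈ S ∧ P.toSet ⊆ Q.toSet} := by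
      have h1 : ∑' P : {P : Cube n // P ∈ S ∧ P.toSet ⊆ Q.toSet}, volume P.1.toSet ≠ ⊤ :=
        ne_top_of_le_ne_top (ENNReal.mul_ne_top ENNReal.ofReal_ne_top (vol_ne_top Q)) hsum
      have h2 := Summable.countable_support_ennreal h1
      rw [← Set.countable_univ_iff]
      refine h2.mono fun P _ => vol_ne_zero _
    set p : Cube n → Prop := fun P =>
      P ∈ {P | P ∈ S ∧ lev S Q0 P % m = (i : ℕ)} ∧ P.toSet ⊆ Q.toSet with hp
    have hc' : Countable {P : Cube n // p P} := by
      have : ({P | P ∈ S ∧ P.toSet ⊆ Q.toSet} : Set (Cube n)).Countable := hc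
      have hsub : ({P | p P} : Set (Cube n)) ⊆ {P | P ∈ S ∧ P.toSet ⊆ Q.toSet} := fun P h => ⟨h.1.1, h.2⟩
      exact this.mono hsub
    rw [tsum_vol _ hc] at hsum
    change ∑' P : {P : Cube n // p P}, volume P.1.toSet ≤ _
    rw [tsum_vol p hc']
    have hmR : (0 : ℝ) < m := by positivity
    have hme : (m : ℝ≥0∞) ≠ 0 := by simp; omega
    have hpt : ∀ x, (m : ℝ≥0∞) * (({P | p P ∧ x ∈ P.toSet}.encard : ℕ∞) : ℝ≥0∞) ≤
        (({P | (P ∈ S ∧ P.toSet ⊆ Q.toSet) ∧ x ∈ P.toSet}.encard : ℕ∞) : ℝ≥0∞)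
          + Q.toSet.indicator (fun _ => ((m - 1 : ℕ) : ℝ≥0∞)) x := by
      intro x
      by_cases hx : x ∈ Q.toSet
      · rw [Set.indicator_of_mem hx]
        set F : Set (Cube n) := {P | (P ∈ S ∧ P.toSet ⊆ Q.toSet) ∧ x ∈ P.toSet} with hF
        by_cases hfin : F.Finite
        · have h := count hD hS (Q := Q) hQ0 m hm (i : ℕ) x F hF hfin
          have e : {P | p P ∧ x ∈ P.toSet} = {P | P ∈ F ∧ lev S Q0 P % m = (i : ℕ)} := by
            ext P; simp only [hp, hF, Set.mem_ofPred_eq]; tauto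
          rw [e, ← hfin.cast_ncard_eq, ← (hfin.subset (fun A h => h.1 :
            {P | P ∈ F ∧ lev S Q0 P % m = (i : ℕ)} ⊆ F)).cast_ncard_eq]
          simp only [ENat.toENNReal_coe]
          exact_mod_cast h
        · rw [Set.Infinite.encard_eq hfin]; simp
      · have e : {P | p P ∧ x ∈ P.toSet} = ∅ := by
          ext P
          simp only [Set.mem_ofPred_eq, Set.mem_empty_iff_false, iff_false]
          exact fun h => hx (h.1.2 h.2)
        rw [e]; simp
    have hint := lintegral_mono hpt (μ := volume)
    rw [lintegral_const_mul' _ _ (by simp), lintegral_add_right _ (measurable_const.indicator (meas Q)),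
      lintegral_indicator_const (meas Q)] at hint
    have hfinal := hint.trans (add_le_add_left hsum _)
    rw [← ENNReal.mul_le_mul_iff_right hme (by simp)]
    refine hfinal.trans (le_of_eq ?_)
    rw [← add_mul, ← mul_assoc]
    congr 1
    rw [← ENNReal.ofReal_natCast, ← ENNReal.ofReal_natCast (n := m),
      ← ENNReal.ofReal_add (by linarith) (by positivity), ← ENNReal.ofReal_mul hmR.le]
    congr 1
    rw [Nat.cast_sub (by omega)]
    field_simp
    push_cast
    ring
end

section
/- Let S ⊂ D be an η-sparse family with disjoint sets E(Q) ⊂ Q, |E(Q)| ≥ η|Q|. Let r_i > 0, p_i > 1 with Σ_{i=1}^m r_i/p_i = 1, set q_i = r_i(1 − 1/p_i) and q = Σ q_i, and suppose the weights w_1,...,w_m satisfy Π_{i=1}^m w_i^{q_i} ≡ 1 and the joint Muckenhoupt condition [w]_S = sup_{Q∈S} Π_i ((w_i)_Q)^{q_i} < ∞. Then for all nonnegative f_i ∈ L^{p_i}(w_i): Σ_{Q∈S} (Π_i (f_i w_i)_Q^{r_i}) |Q| ≤ η^{−τ} Π_i (p_i/(p_i−1))^{r_i} [w]_S^{γ}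 Π_i ‖f_i‖_{L^{p_i}(w_i)}^{r_i}, where γ = max_i p_i' and τ = q · max_i 1/(p_i − 1). -/
open MeasureTheory Set
open scoped ENNReal Classical

/-- The average `(1/|Q|) ∫_Q g` of a (nonnegative) function over a cube, in `ℝ≥0∞`. -/
noncomputable def cubeAvg {n : ℕ} (g : (Fin n → ℝ) → ℝ) (Q : Cube n) : ℝ≥0∞ :=
  (∫⁻ y in Q.toSet, ENNReal.ofReal (g y)) / volume Q.toSet


namespace Cube

theorem toSet_eq {n : ℕ} (Q : Cube n) :
    Q.toSet = Set.pi univ (fun i => Set.Ico (Q.corner i) (Q.corner i + Q.side)) := by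
  ext y; simp [toSet]

theorem volume_toSet {n : ℕ} (Q : Cube n) : volume Q.toSet = ENNReal.ofReal Q.side ^ n := by
  rw [toSet_eq, Real.volume_pi_Ico]; simp

theorem measurableSet_toSet {n : ℕ} (Q : Cube n) : MeasurableSet Q.toSet := by
  rw [toSet_eq]; exact MeasurableSet.univ_pi (fun i => measurableSet_Ico)

theorem volume_pos {n : ℕ} (Q : Cube n) : volume Q.toSet ≠ 0 := by
  rw [volume_toSet]; exact pow_ne_zero _ (by simpa using Q.side_pos)

theorem volume_fin {n : ℕ} (Q : Cube n) : volume Q.toSet ≠ ⊤ := by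
  rw [volume_toSet]; exact ENNReal.pow_ne_top (by simp)

theorem integral_fin {n : ℕ} (Q : Cube n) (w : (Fin n → ℝ) → ℝ)
    (hw : LocallyIntegrable w volume) :
    (∫⁻ y in Q.toSet, ENNReal.ofReal (w y)) ≠ ⊤ := by
  have hsub : Q.toSet ⊆ Set.Icc Q.corner (fun i => Q.corner i + Q.side) := by
    intro y hy
    exact ⟨fun i => (hy i).1, fun i => (hy i).2.le⟩
  have h1 : IntegrableOn w (Set.Icc Q.corner (fun i => Q.corner i + Q.side)) volume :=
    hw.integrableOn_isCompact isCompact_Icc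
  have h2 := (h1.mono_set hsub).lintegral_lt_top
  exact h2.ne

theorem IsChild.subset {n : ℕ} {Q' Q : Cube n} (h : Q'.IsChild Q) : Q'.toSet ⊆ Q.toSet := by
  obtain ⟨hs, ε, hc⟩ := h
  intro y hy i
  have := hy i
  have hp := Q.side_pos
  rw [hs, hc] at this
  simp only at this
  split_ifs at this <;> constructor <;> linarith

theorem IsDescendant.subset {n : ℕ} {Q' Q : Cube n} (h : Q'.IsDescendant Q) :
    Q'.toSet ⊆ Q.toSet := by
  induction h with
  | refl => exact subset_rfl
  | tail _ h ih => exact ih.trans h.subset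

theorem IsChild.eq_or_disjoint {n : ℕ} {Q' Q'' Q : Cube n} (h : Q'.IsChild Q)
    (h' : Q''.IsChild Q) : Q' = Q'' ∨ Disjoint Q'.toSet Q''.toSet := by
  obtain ⟨hs, ε, hc⟩ := h
  obtain ⟨hs', ε', hc'⟩ := h'
  by_cases he : ε = ε'
  · left
    subst he
    cases Q'; cases Q''
    simp only at hs hs' hc hc'
    subst hs hs' hc hc'
    rfl
  · right
    obtain ⟨i, hi⟩ := Function.ne_iff.mp he
    rw [Set.disjoint_left]
    intro y hy hy'
    have a := hy i
    have b := hy' i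
    have hp := Q.side_pos
    rw [hs, hc] at a
    rw [hs', hc'] at b
    simp only at a b
    cases h1 : ε i <;> cases h2 : ε' i <;> simp_all <;> linarith

theorem IsDescendant.nested {n : ℕ} {Q P : Cube n} (h : Q.IsDescendant P) :
    ∀ Q' : Cube n, Q'.IsDescendant P →
      Q.toSet ⊆ Q'.toSet ∨ Q'.toSet ⊆ Q.toSet ∨ Disjoint Q.toSet Q'.toSet := by
  induction h with
  | refl => intro Q' h'; exact Or.inr (Or.inl h'.subset)
  | @tail P1 P h1 hc ih =>
    intro Q' h'
    cases Relation.ReflTransGen.cases_tail h' with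
    | inl h =>
      left
      rw [← h]
      exact (IsDescendant.subset h1).trans hc.subset
    | inr h =>
      obtain ⟨P2, h2, hc2⟩ := h
      rcases hc.eq_or_disjoint hc2 with h | h
      · subst h; exact ih Q' h2
      · right; right
        exact h.mono (IsDescendant.subset h1) (IsDescendant.subset h2)

end Cube

theorem real_key {m : ℕ} (hm : 0 < m) (η : ℝ) (hη : η ∈ Set.Ioo (0 : ℝ) 1)
    (r p : Fin m → ℝ) (hr : ∀ i, 0 < r i) (hp : ∀ i, 1 < p i)
    (hsum : ∑ i, r i / p i = 1) (W e : Fin m → ℝ) (V v K : ℝ) (hV : 0 < V)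
    (he : ∀ i, 0 < e i) (heW : ∀ i, e i ≤ W i) (hv : η * V ≤ v)
    (hK : ∏ i, (W i / V) ^ (r i * (1 - 1 / p i)) ≤ K)
    (hve : v ^ (∑ i, r i * (1 - 1 / p i)) ≤ ∏ i, e i ^ (r i * (1 - 1 / p i))) :
    (∏ i, (W i / V) ^ r i) * V ≤
      η ^ (-((∑ i, r i * (1 - 1 / p i)) * ⨆ i, 1 / (p i - 1))) *
        K ^ (⨆ i, p i / (p i - 1)) * ∏ i, e i ^ (r i / p i) := by
  have : Nonempty (Fin m) := ⟨⟨0, hm⟩⟩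
  set T : ℝ := ⨆ i, 1 / (p i - 1) with hT
  set q : Fin m → ℝ := fun i => r i * (1 - 1 / p i) with hqdef
  change ∏ i, (W i / V) ^ q i ≤ K at hK
  change v ^ (∑ i, q i) ≤ ∏ i, e i ^ q i at hve
  change _ ≤ η ^ (-((∑ i, q i) * T)) * _ * _
  have hp0 : ∀ i, 0 < p i - 1 := fun i => by linarith [hp i]
  have hpp : ∀ i, 0 < p i := fun i => by linarith [hp i]
  have hγ : (⨆ i, p i / (p i - 1)) = 1 + T := by
    have : ∀ i, p i / (p i - 1) = 1 + 1 / (p i - 1) := fun i => by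
      have := (hp0 i).ne'
      field_simp; ring
    simp_rw [this]
    rw [hT, add_ciSup (Set.finite_range _).bddAbove]
  have hTi : ∀ i, 1 / (p i - 1) ≤ T := fun i =>
    le_ciSup (f := fun i => 1 / (p i - 1)) (Set.finite_range _).bddAbove i
  have hT0 : 0 ≤ T := le_trans (by have := hp0 ⟨0, hm⟩; positivity) (hTi ⟨0, hm⟩)
  have hq0 : ∀ i, 0 < q i := fun i => by
    have : q i = r i * ((p i - 1) / p i) := by
      have := (hpp i).ne'
      simp only [hqdef]; field_simp
    rw [this]
    have := hr i; have := hp0 i; have := hpp i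
    positivity
  have hrq : ∀ i, r i / p i = q i * (1 / (p i - 1)) := fun i => by
    have := (hpp i).ne'
    have := (hp0 i).ne'
    simp only [hqdef]; field_simp
  have hrr : ∀ i, r i = q i + r i / p i := fun i => by simp only [hqdef]; ring
  have hW : ∀ i, 0 < W i := fun i => (he i).trans_le (heW i)
  have hP : 0 < ∏ i, (W i / V) ^ q i :=
    Finset.prod_pos fun i _ => Real.rpow_pos_of_pos (div_pos (hW i) hV) _
  have hK0 : 0 < K := hP.trans_le hK
  have hη0 := hη.1
  -- factorization
  have h1 : (∏ i, (W i / V) ^ r i) * V =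
      (∏ i, (W i / V) ^ q i) * (∏ i, (W i / e i) ^ (r i / p i)) * ∏ i, e i ^ (r i / p i) := by
    have hVp : V = ∏ i, V ^ (r i / p i) := by
      rw [← Real.rpow_sum_of_pos hV, hsum, Real.rpow_one]
    nth_rewrite 2 [hVp]
    rw [← Finset.prod_mul_distrib, ← Finset.prod_mul_distrib, ← Finset.prod_mul_distrib]
    refine Finset.prod_congr rfl fun i _ => ?_
    nth_rewrite 1 [hrr i]
    rw [Real.rpow_add (div_pos (hW i) hV), mul_assoc, mul_assoc,
      ← Real.mul_rpow (div_pos (hW i) hV).le hV.le,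
      ← Real.mul_rpow (div_pos (hW i) (he i)).le (he i).le,
      div_mul_cancel₀ _ hV.ne', div_mul_cancel₀ _ (he i).ne']
  have h2 : ∏ i, (W i / e i) ^ (r i / p i) ≤ (∏ i, (W i / e i) ^ q i) ^ T := by
    rw [← Real.finsetProd_rpow _ _ (fun i _ => (Real.rpow_pos_of_pos (div_pos (hW i) (he i)) _).le)]
    refine Finset.prod_le_prod (fun i _ => (Real.rpow_pos_of_pos (div_pos (hW i) (he i)) _).le) ?_
    intro i _
    rw [← Real.rpow_mul (div_pos (hW i) (he i)).le, hrq i]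
    exact Real.rpow_le_rpow_of_exponent_le ((one_le_div (he i)).2 (heW i))
      (mul_le_mul_of_nonneg_left (hTi i) (hq0 i).le)
  have h3 : ∏ i, (W i / e i) ^ q i ≤ K * η ^ (-(∑ i, q i)) := by
    have hep : 0 < ∏ i, e i ^ q i := Finset.prod_pos fun i _ => Real.rpow_pos_of_pos (he i) _
    have a : ∏ i, (W i / e i) ^ q i =
        (∏ i, (W i / V) ^ q i) * (V ^ (∑ i, q i) / ∏ i, e i ^ q i) := by
      rw [Real.rpow_sum_of_pos hV, ← Finset.prod_div_distrib, ← Finset.prod_mul_distrib]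
      refine Finset.prod_congr rfl fun i _ => ?_
      rw [← Real.div_rpow hV.le (he i).le, ← Real.mul_rpow (div_pos (hW i) hV).le
        (div_pos hV (he i)).le]
      congr 1
      field_simp [hV.ne', (he i).ne']
    rw [a]
    refine mul_le_mul hK ?_ (by positivity) hK0.le
    rw [div_le_iff₀ hep]
    have hs : 0 ≤ ∑ i, q i := Finset.sum_nonneg fun i _ => (hq0 i).le
    have b : (η * V) ^ (∑ i, q i) ≤ ∏ i, e i ^ q i :=
      (Real.rpow_le_rpow (by positivity) hv hs).trans hve
    rw [Real.mul_rpow hη0.le hV.le] at b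
    calc V ^ (∑ i, q i) = η ^ (-(∑ i, q i)) * (η ^ (∑ i, q i) * V ^ (∑ i, q i)) := by
          rw [← mul_assoc, ← Real.rpow_add hη0]; simp
      _ ≤ _ := mul_le_mul_of_nonneg_left b (by positivity)
  rw [h1, hγ]
  refine mul_le_mul_of_nonneg_right ?_
    (Finset.prod_nonneg fun i _ => (Real.rpow_pos_of_pos (he i) _).le)
  have hpe : 0 ≤ ∏ i, (W i / e i) ^ q i :=
    Finset.prod_nonneg fun i _ => (Real.rpow_pos_of_pos (div_pos (hW i) (he i)) _).le
  calc (∏ i, (W i / V) ^ q i) * (∏ i, (W i / e i) ^ (r i / p i))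
      ≤ K * (K * η ^ (-(∑ i, q i))) ^ T := by
        refine mul_le_mul hK (h2.trans (Real.rpow_le_rpow hpe h3 hT0)) ?_ hK0.le
        exact Finset.prod_nonneg fun i _ => (Real.rpow_pos_of_pos (div_pos (hW i) (he i)) _).le
    _ = η ^ (-((∑ i, q i) * T)) * K ^ (1 + T) := by
        rw [Real.mul_rpow hK0.le (by positivity), ← Real.rpow_mul hη0.le, Real.rpow_add hK0,
          Real.rpow_one, neg_mul]
        ring

theorem exists_disjoint_subfamily {Ω ι : Type*} (Q : ι → Set Ω)
    (hQ : ∀ i j, Q i ⊆ Q j ∨ Q j ⊆ Q i ∨ Disjoint (Q i) (Q j)) (G : Finset ι) :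
    ∃ G' : Finset ι, G' ⊆ G ∧ (G' : Set ι).PairwiseDisjoint Q ∧
      (⋃ i ∈ G', Q i) = ⋃ i ∈ G, Q i := by
  induction G using Finset.induction_on with
  | empty => exact ⟨∅, by simp⟩
  | insert a G ha ih =>
    obtain ⟨G', hsub, hd, hU⟩ := ih
    by_cases h : ∃ b ∈ G', Q a ⊆ Q b
    · obtain ⟨b, hb, hab⟩ := h
      refine ⟨G', hsub.trans (Finset.subset_insert _ _), hd, ?_⟩
      rw [Finset.set_biUnion_insert, ← hU]
      symm
      apply Set.union_eq_self_of_subset_left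
      exact hab.trans (Set.subset_biUnion_of_mem (u := Q) hb)
    · push Not at h
      refine ⟨insert a (G'.filter fun b => Disjoint (Q a) (Q b)), ?_, ?_, ?_⟩
      · exact Finset.insert_subset_insert _ ((Finset.filter_subset _ _).trans hsub)
      · rw [Finset.coe_insert, Set.pairwiseDisjoint_insert]
        refine ⟨hd.subset (by intro x hx; simp at hx; exact hx.1), ?_⟩
        intro j hj _
        simp at hj
        exact hj.2
      · rw [Finset.set_biUnion_insert, Finset.set_biUnion_insert, ← hU]
        apply Set.Subset.antisymm
        · apply Set.union_subset_union_right
          intro x hx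
          simp only [Set.mem_iUnion, Finset.mem_filter] at hx ⊢
          obtain ⟨i, hi, hx⟩ := hx
          exact ⟨i, hi.1, hx⟩
        · intro x hx
          rcases hx with hx | hx
          · exact Or.inl hx
          · simp only [Set.mem_iUnion] at hx
            obtain ⟨i, hi, hx⟩ := hx
            rcases hQ a i with h1 | h1 | h1
            · exact absurd h1 (h i hi)
            · exact Or.inl (h1 hx)
            · right
              simp only [Set.mem_iUnion, Finset.mem_filter]
              exact ⟨i, ⟨hi, h1⟩, hx⟩

theorem weak_type {Ω ι : Type*} [MeasurableSpace Ω] (μ : Measure Ω) (Q : ι → Set Ω)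
    (hQm : ∀ i, MeasurableSet (Q i))
    (hQ : ∀ i j, Q i ⊆ Q j ∨ Q j ⊆ Q i ∨ Disjoint (Q i) (Q j)) (f : Ω → ℝ≥0∞)
    (t : ℝ≥0∞) (G : Finset ι) (hG : ∀ i ∈ G, t * μ (Q i) ≤ ∫⁻ x in Q i, f x ∂μ) :
    t * μ (⋃ i ∈ G, Q i) ≤ ∫⁻ x in ⋃ i ∈ G, Q i, f x ∂μ := by
  obtain ⟨G', hsub, hd, hU⟩ := exists_disjoint_subfamily Q hQ G
  rw [← hU, measure_biUnion_finset hd (fun i _ => hQm i),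
    lintegral_biUnion_finset hd (fun i _ => hQm i), Finset.mul_sum]
  exact Finset.sum_le_sum fun i hi => hG i (hsub hi)

theorem absorb {p : ℝ} (hp : 1 < p) (N F c : ℝ≥0∞) (hN : N ≠ ⊤)
    (h : N ≤ c * (F ^ (1 / p) * N ^ (1 - 1 / p))) : N ≤ c ^ p * F := by
  have hp0 : 0 < p := by linarith
  by_cases h0 : N = 0
  · simp [h0]
  have hx0 : N ^ (1 - 1 / p) ≠ 0 := by
    simp [ENNReal.rpow_eq_zero_iff, h0, hN]
  have hxt : N ^ (1 - 1 / p) ≠ ⊤ := by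
    simp [ENNReal.rpow_eq_top_iff, h0, hN]
  have h1 : N ^ (1 / p) * N ^ (1 - 1 / p) ≤ c * F ^ (1 / p) * N ^ (1 - 1 / p) := by
    rw [← ENNReal.rpow_add _ _ h0 hN]
    simpa [mul_assoc] using h
  have h2 : N ^ (1 / p) ≤ c * F ^ (1 / p) := (ENNReal.mul_le_mul_iff_left hx0 hxt).1 h1
  have h3 := ENNReal.rpow_le_rpow h2 hp0.le
  rw [ENNReal.mul_rpow_of_nonneg _ _ hp0.le, ← ENNReal.rpow_mul, ← ENNReal.rpow_mul,
    one_div_mul_cancel hp0.ne', ENNReal.rpow_one, ENNReal.rpow_one] at h3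
  exact h3

theorem maximal_finset {Ω ι : Type*} [MeasurableSpace Ω] (μ : Measure Ω) (Q E : ι → Set Ω)
    (hQm : ∀ i, MeasurableSet (Q i)) (hEm : ∀ i, MeasurableSet (E i)) (hEQ : ∀ i, E i ⊆ Q i)
    (hQ : ∀ i j, Q i ⊆ Q j ∨ Q j ⊆ Q i ∨ Disjoint (Q i) (Q j))
    (hEd : Pairwise (Function.onFun Disjoint E))
    (hμ0 : ∀ i, μ (Q i) ≠ 0) (hμt : ∀ i, μ (Q i) ≠ ⊤)
    (f : Ω → ℝ≥0∞) (hf : Measurable f) {p : ℝ} (hp : 1 < p)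
    (hfp : ∫⁻ x, f x ^ p ∂μ ≠ ⊤) (G : Finset ι) :
    ∑ i ∈ G, ((∫⁻ x in Q i, f x ∂μ) / μ (Q i)) ^ p * μ (E i) ≤
      ENNReal.ofReal (p / (p - 1)) ^ p * ∫⁻ x, f x ^ p ∂μ := by
  have hp0 : 0 < p := by linarith
  have hp1 : 0 < p - 1 := by linarith
  have hIt : ∀ i, (∫⁻ x in Q i, f x ∂μ) ≠ ⊤ := by
    intro i
    have h1 : (∫⁻ x in Q i, f x ∂μ) ≤ ∫⁻ x in Q i, (1 + f x ^ p) ∂μ := by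
      refine lintegral_mono fun x => ?_
      rcases le_total (f x) 1 with h | h
      · exact h.trans le_self_add
      · refine le_trans ?_ le_add_self
        simpa using ENNReal.rpow_le_rpow_of_exponent_le h hp.le
    rw [lintegral_add_left measurable_const] at h1
    refine ne_top_of_le_ne_top ?_ h1
    rw [setLIntegral_const, one_mul]
    exact ENNReal.add_ne_top.2 ⟨hμt i, ne_top_of_le_ne_top hfp (setLIntegral_le_lintegral _ _)⟩
  set A : ι → NNReal := fun i => ((∫⁻ x in Q i, f x ∂μ) / μ (Q i)).toNNReal with hA
  have hAc : ∀ i, (A i : ℝ≥0∞) = (∫⁻ x in Q i, f x ∂μ) / μ (Q i) := fun i =>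
    ENNReal.coe_toNNReal (ENNReal.div_ne_top (hIt i) (hμ0 i))
  set M : Ω → NNReal := fun x => G.sup fun i => (Q i).indicator (fun _ => A i) x with hM
  have hset : ∀ t : ℝ, 0 ≤ t → {x | t < (M x : ℝ)} =
      ⋃ i ∈ G.filter (fun i => t < (A i : ℝ)), Q i := by
    intro t ht
    lift t to NNReal using ht
    ext x
    simp only [Set.mem_ofPred_eq, NNReal.coe_lt_coe, hM, Finset.lt_sup_iff, Set.mem_iUnion,
      Finset.mem_filter]
    constructor
    · rintro ⟨i, hi, h⟩
      by_cases hx : x ∈ Q i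
      · rw [Set.indicator_of_mem hx] at h
        exact ⟨i, ⟨hi, h⟩, hx⟩
      · rw [Set.indicator_of_notMem hx] at h
        exact absurd h not_lt_zero
    · rintro ⟨i, ⟨hi, h⟩, hx⟩
      exact ⟨i, hi, by rwa [Set.indicator_of_mem hx]⟩
  have hMm : Measurable M := by
    have : ∀ G : Finset ι, Measurable fun x => G.sup fun i => (Q i).indicator (fun _ => A i) x := by
      intro G
      induction G using Finset.induction_on with
      | empty => simp only [Finset.sup_empty]; exact measurable_const
      | insert a G ha ih =>
        simp only [Finset.sup_insert]
        exact (measurable_const.indicator (hQm a)).sup ih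
    exact this G
  have hMr : Measurable fun x => (M x : ℝ) := hMm.coe_nnreal_real
  have hMnn : ∀ x, 0 ≤ (M x : ℝ) := fun x => (M x).2
  have hMleA : ∀ i ∈ G, ∀ x ∈ Q i, A i ≤ M x := by
    intro i hi x hx
    have := Finset.le_sup (f := fun i => (Q i).indicator (fun _ => A i) x) hi
    simp only [Set.indicator_of_mem hx] at this
    exact this
  set N : ℝ≥0∞ := ∫⁻ x, (M x : ℝ≥0∞) ^ p ∂μ with hN
  have hNt : N ≠ ⊤ := by
    have h1 : ∀ x, (M x : ℝ≥0∞) ^ p ≤ ∑ i ∈ G, (Q i).indicator (fun _ => (A i : ℝ≥0∞) ^ p) x := by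
      intro x
      rcases G.eq_empty_or_nonempty with hG | hG
      · simp [hM, hG, hp0]
      · obtain ⟨i, hi, h⟩ := Finset.exists_mem_eq_sup G hG
          (fun i => (Q i).indicator (fun _ => A i) x)
        have : (M x : ℝ≥0∞) ^ p = (Q i).indicator (fun _ => (A i : ℝ≥0∞) ^ p) x := by
          simp only [hM]
          rw [h]
          by_cases hx : x ∈ Q i
          · simp [hx]
          · simp [hx, hp0]
        rw [this]
        exact Finset.single_le_sum
          (f := fun i => (Q i).indicator (fun _ => (A i : ℝ≥0∞) ^ p) x) (fun _ _ => zero_le) hi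
    refine ne_top_of_le_ne_top ?_ (lintegral_mono h1)
    rw [lintegral_finsetSum _ (fun i _ => measurable_const.indicator (hQm i))]
    refine (ENNReal.sum_lt_top.2 fun i _ => ?_).ne
    rw [lintegral_indicator_const (hQm i)]
    exact ENNReal.mul_lt_top (ENNReal.rpow_lt_top_of_nonneg hp0.le ENNReal.coe_ne_top)
      (hμt i).lt_top
  have hcoe : ∀ s : ℝ, 0 ≤ s → ∀ x, ENNReal.ofReal ((M x : ℝ) ^ s) = (M x : ℝ≥0∞) ^ s := by
    intro s hs x
    rw [← ENNReal.ofReal_rpow_of_nonneg (hMnn x) hs, ENNReal.ofReal_coe_nnreal]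
  set ν := μ.withDensity f with hν
  have hL1 : N = ENNReal.ofReal p *
      ∫⁻ t in Ioi 0, μ {a : Ω | t < (M a : ℝ)} * ENNReal.ofReal (t ^ (p - 1)) := by
    rw [← lintegral_rpow_eq_lintegral_meas_lt_mul μ (Filter.Eventually.of_forall hMnn)
      hMr.aemeasurable hp0]
    simp_rw [hcoe p hp0.le]
    exact hN
  have hL2 : ∫⁻ x, f x * (M x : ℝ≥0∞) ^ (p - 1) ∂μ = ENNReal.ofReal (p - 1) *
      ∫⁻ t in Ioi 0, ν {a : Ω | t < (M a : ℝ)} * ENNReal.ofReal (t ^ (p - 1 - 1)) := by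
    rw [← lintegral_rpow_eq_lintegral_meas_lt_mul ν (Filter.Eventually.of_forall hMnn)
      hMr.aemeasurable hp1]
    simp_rw [hcoe (p - 1) hp1.le]
    rw [hν, lintegral_withDensity_eq_lintegral_mul _ hf (by fun_prop)]
    rfl
  have hcmp : ∫⁻ t in Ioi (0:ℝ), μ {a : Ω | t < (M a : ℝ)} * ENNReal.ofReal (t ^ (p - 1)) ≤
      ∫⁻ t in Ioi (0:ℝ), ν {a : Ω | t < (M a : ℝ)} * ENNReal.ofReal (t ^ (p - 1 - 1)) := by
    refine setLIntegral_mono' measurableSet_Ioi fun t ht => ?_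
    have ht : 0 < t := ht
    have hms : MeasurableSet {a : Ω | t < (M a : ℝ)} := measurableSet_lt measurable_const hMr
    have hw : ENNReal.ofReal t * μ {a : Ω | t < (M a : ℝ)} ≤ ν {a : Ω | t < (M a : ℝ)} := by
      rw [hν, withDensity_apply _ hms, hset t ht.le]
      refine weak_type μ Q hQm hQ f _ _ fun i hi => ?_
      have hi := (Finset.mem_filter.1 hi).2
      have : ENNReal.ofReal t ≤ A i := by
        rw [← ENNReal.ofReal_coe_nnreal]; exact ENNReal.ofReal_le_ofReal hi.le
      rw [hAc i] at this
      rwa [ENNReal.le_div_iff_mul_le (Or.inl (hμ0 i)) (Or.inl (hμt i))] at this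
    calc μ {a : Ω | t < (M a : ℝ)} * ENNReal.ofReal (t ^ (p - 1))
        = (ENNReal.ofReal t * μ {a : Ω | t < (M a : ℝ)}) * ENNReal.ofReal (t ^ (p - 1 - 1)) := by
          rw [mul_comm (ENNReal.ofReal t), mul_assoc, ← ENNReal.ofReal_mul ht.le]
          congr 2
          rw [Real.rpow_sub_one ht.ne' (p - 1)]
          field_simp
      _ ≤ _ := by gcongr
  have hpq : p.HolderConjugate (p / (p - 1)) := Real.HolderConjugate.conjExponent hp
  have hH : ∫⁻ x, f x * (M x : ℝ≥0∞) ^ (p - 1) ∂μ ≤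
      (∫⁻ x, f x ^ p ∂μ) ^ (1 / p) * N ^ (1 - 1 / p) := by
    have := ENNReal.lintegral_mul_le_Lp_mul_Lq μ hpq hf.aemeasurable
      (g := fun x => (M x : ℝ≥0∞) ^ (p - 1)) (by fun_prop)
    refine this.trans (le_of_eq ?_)
    congr 1
    have e1 : 1 / (p / (p - 1)) = 1 - 1 / p := by field_simp
    rw [e1, hN]
    congr 1
    refine lintegral_congr fun x => ?_
    rw [← ENNReal.rpow_mul]
    congr 1
    field_simp
  have hmain : N ≤ ENNReal.ofReal (p / (p - 1)) * ((∫⁻ x, f x ^ p ∂μ) ^ (1 / p) *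
      N ^ (1 - 1 / p)) := by
    refine le_trans ?_ (mul_le_mul_right hH _)
    rw [hL2, ← mul_assoc, ← ENNReal.ofReal_mul (by positivity), div_mul_cancel₀ _ hp1.ne', hL1]
    exact mul_le_mul_right hcmp _
  refine le_trans ?_ (absorb hp N _ _ hNt hmain)
  calc ∑ i ∈ G, ((∫⁻ x in Q i, f x ∂μ) / μ (Q i)) ^ p * μ (E i)
      ≤ ∑ i ∈ G, ∫⁻ x in E i, (M x : ℝ≥0∞) ^ p ∂μ := by
        refine Finset.sum_le_sum fun i hi => ?_
        rw [← hAc i, ← setLIntegral_const]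
        refine setLIntegral_mono' (hEm i) fun x hx => ?_
        exact ENNReal.rpow_le_rpow (ENNReal.coe_le_coe.2 (hMleA i hi x (hEQ i hx))) hp0.le
    _ = ∫⁻ x in ⋃ i ∈ G, E i, (M x : ℝ≥0∞) ^ p ∂μ := by
        rw [lintegral_biUnion_finset (fun i _ j _ h => hEd h) (fun i _ => hEm i)]
    _ ≤ N := setLIntegral_le_lintegral _ _

theorem ofReal_prod_rpow {m : ℕ} (x s : Fin m → ℝ) (hx : ∀ i, 0 < x i) :
    ∏ i, ENNReal.ofReal (x i) ^ s i = ENNReal.ofReal (∏ i, x i ^ s i) := by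
  rw [ENNReal.ofReal_prod_of_nonneg fun i _ => (Real.rpow_pos_of_pos (hx i) _).le]
  exact Finset.prod_congr rfl fun i _ => ENNReal.ofReal_rpow_of_pos (hx i)

theorem ennreal_key {m : ℕ} (hm : 0 < m) (η : ℝ) (hη : η ∈ Set.Ioo (0 : ℝ) 1)
    (r p : Fin m → ℝ) (hr : ∀ i, 0 < r i) (hp : ∀ i, 1 < p i)
    (hsum : ∑ i, r i / p i = 1) (W e : Fin m → ℝ≥0∞) (V v K : ℝ≥0∞) (hV : V ≠ 0) (hVt : V ≠ ⊤)
    (hvV : v ≤ V)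
    (he : ∀ i, e i ≠ 0) (heW : ∀ i, e i ≤ W i) (hWt : ∀ i, W i ≠ ⊤)
    (hv : ENNReal.ofReal η * V ≤ v) (hKt : K ≠ ⊤)
    (hK : ∏ i, (W i / V) ^ (r i * (1 - 1 / p i)) ≤ K)
    (hve : v ^ (∑ i, r i * (1 - 1 / p i)) ≤ ∏ i, e i ^ (r i * (1 - 1 / p i))) :
    (∏ i, (W i / V) ^ r i) * V ≤
      ENNReal.ofReal (η ^ (-((∑ i, r i * (1 - 1 / p i)) * ⨆ i, 1 / (p i - 1)))) *
        K ^ (⨆ i, p i / (p i - 1)) * ∏ i, e i ^ (r i / p i) := by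
  have hη0 := hη.1
  have hvt : v ≠ ⊤ := ne_top_of_le_ne_top hVt hvV
  have het : ∀ i, e i ≠ ⊤ := fun i => ne_top_of_le_ne_top (hWt i) (heW i)
  have hW0 : ∀ i, W i ≠ 0 := fun i h => he i (le_zero_iff.1 (h ▸ heW i))
  have hv0 : v ≠ 0 := fun h => by
    rw [h] at hv
    have := le_zero_iff.1 hv
    simp only [mul_eq_zero, ENNReal.ofReal_eq_zero, not_le.2 hη0, hV, or_self] at this
  have hVr : 0 < V.toReal := ENNReal.toReal_pos hV hVt
  have hvr : 0 < v.toReal := ENNReal.toReal_pos hv0 hvt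
  have her : ∀ i, 0 < (e i).toReal := fun i => ENNReal.toReal_pos (he i) (het i)
  have hWr : ∀ i, 0 < (W i).toReal := fun i => ENNReal.toReal_pos (hW0 i) (hWt i)
  have hWV : ∀ i, W i / V = ENNReal.ofReal ((W i).toReal / V.toReal) := fun i => by
    rw [ENNReal.ofReal_div_of_pos hVr, ENNReal.ofReal_toReal hVt, ENNReal.ofReal_toReal (hWt i)]
  have hee : ∀ i, e i = ENNReal.ofReal (e i).toReal := fun i => (ENNReal.ofReal_toReal (het i)).symm
  have hWVr : ∀ i, 0 < (W i).toReal / V.toReal := fun i => div_pos (hWr i) hVr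
  have eK : K = ENNReal.ofReal K.toReal := (ENNReal.ofReal_toReal hKt).symm
  have eV : V = ENNReal.ofReal V.toReal := (ENNReal.ofReal_toReal hVt).symm
  have ev : v = ENNReal.ofReal v.toReal := (ENNReal.ofReal_toReal hvt).symm
  have hPK : ∏ i, ((W i).toReal / V.toReal) ^ (r i * (1 - 1 / p i)) ≤ K.toReal := by
    simp_rw [hWV] at hK
    rw [ofReal_prod_rpow _ _ hWVr, eK] at hK
    exact (ENNReal.ofReal_le_ofReal_iff ENNReal.toReal_nonneg).1 hK
  have hK0 : 0 < K.toReal :=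
    (Finset.prod_pos fun i _ => Real.rpow_pos_of_pos (hWVr i) _).trans_le hPK
  have hPe : v.toReal ^ (∑ i, r i * (1 - 1 / p i)) ≤
      ∏ i, (e i).toReal ^ (r i * (1 - 1 / p i)) := by
    rw [Finset.prod_congr rfl (fun i _ => by rw [← hee i] :
      ∀ i ∈ Finset.univ, e i ^ (r i * (1 - 1 / p i)) =
        ENNReal.ofReal (e i).toReal ^ (r i * (1 - 1 / p i))),
      ofReal_prod_rpow _ _ her, ev, ENNReal.ofReal_rpow_of_pos hvr] at hve
    exact (ENNReal.ofReal_le_ofReal_iff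
      (Finset.prod_nonneg fun i _ => (Real.rpow_pos_of_pos (her i) _).le)).1 hve
  have hv' : η * V.toReal ≤ v.toReal := by
    have := ENNReal.toReal_mono hvt hv
    rwa [ENNReal.toReal_mul, ENNReal.toReal_ofReal hη0.le] at this
  have key := real_key hm η hη r p hr hp hsum (fun i => (W i).toReal) (fun i => (e i).toReal)
    V.toReal v.toReal K.toReal hVr her (fun i => ENNReal.toReal_mono (hWt i) (heW i)) hv' hPK hPe
  have key2 := ENNReal.ofReal_le_ofReal key
  rw [ENNReal.ofReal_mul (Finset.prod_nonneg fun i _ => (Real.rpow_pos_of_pos (hWVr i) _).le),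
    ENNReal.ofReal_mul (by positivity), ENNReal.ofReal_mul (by positivity),
    ← ofReal_prod_rpow _ _ hWVr, ← ofReal_prod_rpow _ _ her, ← ENNReal.ofReal_rpow_of_pos hK0,
    ← eK, ← eV] at key2
  simp_rw [← hWV, ← hee] at key2
  exact key2

theorem sparse_multilinear_form_bound {n m : ℕ} (hm : 0 < m)
    (D S : Set (Cube n)) (hD : IsDyadicLattice D) (hS : S ⊆ D)
    (η : ℝ) (hη : η ∈ Set.Ioo (0 : ℝ) 1)
    (E : Cube n → Set (Fin n → ℝ))
    (hE : ∀ Q ∈ S, E Q ⊆ Q.toSet ∧ MeasurableSet (E Q) ∧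
      ENNReal.ofReal η * volume Q.toSet ≤ volume (E Q))
    (hEdisj : S.PairwiseDisjoint E)
    (r p : Fin m → ℝ) (hr : ∀ i, 0 < r i) (hp : ∀ i, 1 < p i)
    (hsum : ∑ i, r i / p i = 1)
    (w : Fin m → (Fin n → ℝ) → ℝ)
    (hw : ∀ i x, 0 < w i x) (hwm : ∀ i, Measurable (w i))
    (hwloc : ∀ i, LocallyIntegrable (w i) volume)
    (hwprod : ∀ x, ∏ i, (w i x) ^ (r i * (1 - 1 / p i)) = 1)
    (hA : (⨆ Q : S, ∏ i, cubeAvg (w i) Q.1 ^ (r i * (1 - 1 / p i))) < ⊤)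
    (f : Fin m → (Fin n → ℝ) → ℝ)
    (hf : ∀ i x, 0 ≤ f i x) (hfm : ∀ i, Measurable (f i))
    (hfLp : ∀ i, (∫⁻ x, ENNReal.ofReal (f i x) ^ (p i) * ENNReal.ofReal (w i x)) < ⊤) :
    ∑' Q : S, (∏ i, cubeAvg (fun x => f i x * w i x) Q.1 ^ (r i)) * volume Q.1.toSet ≤
      ENNReal.ofReal
          (η ^ (-((∑ i, r i * (1 - 1 / p i)) * ⨆ i, 1 / (p i - 1)))) *
        (∏ i, ENNReal.ofReal ((p i / (p i - 1)) ^ (r i))) *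
        (⨆ Q : S, ∏ i, cubeAvg (w i) Q.1 ^ (r i * (1 - 1 / p i))) ^
          (⨆ i, p i / (p i - 1)) *
        ∏ i, (∫⁻ x, ENNReal.ofReal (f i x) ^ (p i) * ENNReal.ofReal (w i x)) ^
          (r i / p i) := by
  
  have : Nonempty (Fin m) := ⟨⟨0, hm⟩⟩
  have hpp : ∀ i, 0 < p i := fun i => by linarith [hp i]
  have hq0 : ∀ i, 0 < r i * (1 - 1 / p i) := fun i =>
    mul_pos (hr i) (by rw [sub_pos, div_lt_one (hpp i)]; exact hp i)
  set K : ℝ≥0∞ := ⨆ Q : S, ∏ i, cubeAvg (w i) Q.1 ^ (r i * (1 - 1 / p i)) with hKdef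
  set q : Fin m → ℝ := fun i => r i * (1 - 1 / p i) with hq
  set C0 : ℝ≥0∞ := ENNReal.ofReal
    (η ^ (-((∑ i, r i * (1 - 1 / p i)) * ⨆ i, 1 / (p i - 1)))) with hC0
  set γ : ℝ := ⨆ i, p i / (p i - 1) with hγ
  have hwe : ∀ i, Measurable fun x => ENNReal.ofReal (w i x) := fun i =>
    ENNReal.measurable_ofReal.comp (hwm i)
  have hfe : ∀ i, Measurable fun x => ENNReal.ofReal (f i x) := fun i =>
    ENNReal.measurable_ofReal.comp (hfm i)
  set μ : Fin m → Measure (Fin n → ℝ) := fun i =>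
    volume.withDensity fun x => ENNReal.ofReal (w i x) with hμ
  have hμset : ∀ i s, MeasurableSet s → μ i s = ∫⁻ x in s, ENNReal.ofReal (w i x) :=
    fun i s hs => withDensity_apply _ hs
  have hμQt : ∀ i (Q : Cube n), μ i Q.toSet ≠ ⊤ := fun i Q => by
    rw [hμset i _ Q.measurableSet_toSet]
    exact Q.integral_fin _ (hwloc i)
  have hvE : ∀ Q : S, volume (E Q.1) ≠ 0 := fun Q h => by
    have := (hE Q.1 Q.2).2.2
    rw [h] at this
    have := le_zero_iff.1 this
    simp only [mul_eq_zero, ENNReal.ofReal_eq_zero, not_le.2 hη.1, Q.1.volume_pos, or_self] at this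
  have hμE : ∀ i (Q : S), μ i (E Q.1) ≠ 0 := fun i Q => by
    rw [hμset i _ (hE Q.1 Q.2).2.1]
    refine (setLIntegral_pos_iff (hwe i) |>.2 ?_).ne'
    have : Function.support (fun x => ENNReal.ofReal (w i x)) = Set.univ := by
      ext x; simp [hw i x]
    rw [this, Set.univ_inter]
    exact pos_iff_ne_zero.2 (hvE Q)
  have hμEQ : ∀ i (Q : S), μ i (E Q.1) ≤ μ i Q.1.toSet := fun i Q => measure_mono (hE Q.1 Q.2).1
  have hμQ0 : ∀ i (Q : S), μ i Q.1.toSet ≠ 0 := fun i Q h =>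
    hμE i Q (le_zero_iff.1 (h ▸ hμEQ i Q))
  set A : Fin m → S → ℝ≥0∞ := fun i Q =>
    (∫⁻ x in Q.1.toSet, ENNReal.ofReal (f i x) ∂μ i) / μ i Q.1.toSet with hA'
  have hmax : ∀ i, ∑' Q : S, A i Q ^ p i * μ i (E Q.1) ≤
      ENNReal.ofReal (p i / (p i - 1)) ^ p i *
        ∫⁻ x, ENNReal.ofReal (f i x) ^ (p i) * ENNReal.ofReal (w i x) := by
    intro i
    have hint : ∫⁻ x, ENNReal.ofReal (f i x) ^ (p i) ∂μ i =
        ∫⁻ x, ENNReal.ofReal (f i x) ^ (p i) * ENNReal.ofReal (w i x) := by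
      rw [hμ, lintegral_withDensity_eq_lintegral_mul _ (hwe i) ((hfe i).pow_const _)]
      exact lintegral_congr fun x => mul_comm _ _
    rw [← hint, ENNReal.tsum_eq_iSup_sum]
    refine iSup_le fun G => ?_
    refine maximal_finset (μ i) (fun Q : S => Q.1.toSet) (fun Q : S => E Q.1)
      (fun Q => Q.1.measurableSet_toSet) (fun Q => (hE Q.1 Q.2).2.1) (fun Q => (hE Q.1 Q.2).1)
      ?_ ?_ (hμQ0 i) (fun Q => hμQt i Q.1) _ (hfe i) (hp i) ?_ G
    · intro Q Q'
      obtain ⟨P, _, h1, h2⟩ := hD.2.1 Q.1 (hS Q.2) Q'.1 (hS Q'.2)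
      exact h1.nested _ h2
    · intro Q Q' hne
      exact hEdisj Q.2 Q'.2 (fun h => hne (Subtype.ext h))
    · rw [hint]; exact (hfLp i).ne
  have hqs : 0 < ∑ i, q i := Finset.sum_pos (fun i _ => hq0 i) Finset.univ_nonempty
  have hvol : ∀ Q : S, volume (E Q.1) ^ (∑ i, q i) ≤ ∏ i, μ i (E Q.1) ^ q i := by
    intro Q
    have h1 := ENNReal.lintegral_prod_norm_pow_le (μ := volume.restrict (E Q.1)) Finset.univ
      (f := fun i x => ENNReal.ofReal (w i x)) (fun i _ => (hwe i).aemeasurable)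
      (p := fun i => q i / ∑ j, q j) (by rw [← Finset.sum_div, div_self hqs.ne'])
      (fun i _ => (div_pos (hq0 i) hqs).le)
    have h2 : ∀ x, ∏ i, ENNReal.ofReal (w i x) ^ (q i / ∑ j, q j) = 1 := by
      intro x
      have : ∀ i, ENNReal.ofReal (w i x) ^ (q i / ∑ j, q j) =
          (ENNReal.ofReal (w i x) ^ q i) ^ (1 / ∑ j, q j) := fun i => by
        rw [← ENNReal.rpow_mul, mul_one_div]
      simp_rw [this]
      rw [ENNReal.prod_rpow_of_nonneg (one_div_pos.2 hqs).le,
        ofReal_prod_rpow _ _ (fun i => hw i x), hwprod x]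
      simp
    simp_rw [h2] at h1
    rw [setLIntegral_const, one_mul] at h1
    have h3 := ENNReal.rpow_le_rpow h1 hqs.le
    rw [← ENNReal.prod_rpow_of_nonneg hqs.le] at h3
    refine h3.trans (le_of_eq (Finset.prod_congr rfl fun i _ => ?_))
    rw [← ENNReal.rpow_mul, div_mul_cancel₀ _ hqs.ne', hμset i _ (hE Q.1 Q.2).2.1]
  have hpt : ∀ Q : S, (∏ i, cubeAvg (fun x => f i x * w i x) Q.1 ^ (r i)) * volume Q.1.toSet ≤
      C0 * K ^ γ * ∏ i, (A i Q ^ p i * μ i (E Q.1)) ^ (r i / p i) := by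
    intro Q
    have hwavg : ∀ i, cubeAvg (w i) Q.1 = μ i Q.1.toSet / volume Q.1.toSet := fun i => by
      rw [cubeAvg, hμset i _ Q.1.measurableSet_toSet]
    have hfavg : ∀ i, cubeAvg (fun x => f i x * w i x) Q.1 =
        A i Q * (μ i Q.1.toSet / volume Q.1.toSet) := fun i => by
      have : ∫⁻ x in Q.1.toSet, ENNReal.ofReal (f i x) ∂μ i =
          ∫⁻ x in Q.1.toSet, ENNReal.ofReal (f i x * w i x) := by
        rw [hμ, setLIntegral_withDensity_eq_setLIntegral_mul _ (hwe i) (hfe i)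
          Q.1.measurableSet_toSet]
        refine lintegral_congr fun x => ?_
        rw [ENNReal.ofReal_mul (hf i x), Pi.mul_apply, mul_comm]
      rw [cubeAvg, hA']
      simp only
      rw [this, ← mul_div_assoc, ENNReal.div_mul_cancel (hμQ0 i Q) (hμQt i Q.1)]
    have hKQ : ∏ i, (μ i Q.1.toSet / volume Q.1.toSet) ^ (r i * (1 - 1 / p i)) ≤ K := by
      simp_rw [← hwavg]
      exact le_iSup (fun Q : S => ∏ i, cubeAvg (w i) Q.1 ^ (r i * (1 - 1 / p i))) Q
    have key := ennreal_key hm η hη r p hr hp hsum (fun i => μ i Q.1.toSet)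
      (fun i => μ i (E Q.1)) (volume Q.1.toSet) (volume (E Q.1)) K Q.1.volume_pos Q.1.volume_fin
      (measure_mono (hE Q.1 Q.2).1) (fun i => hμE i Q) (fun i => hμEQ i Q)
      (fun i => hμQt i Q.1) (hE Q.1 Q.2).2.2 hA.ne hKQ (hvol Q)
    calc (∏ i, cubeAvg (fun x => f i x * w i x) Q.1 ^ (r i)) * volume Q.1.toSet
        = (∏ i, A i Q ^ r i) *
          ((∏ i, (μ i Q.1.toSet / volume Q.1.toSet) ^ r i) * volume Q.1.toSet) := by
          rw [← mul_assoc, ← Finset.prod_mul_distrib]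
          congr 1
          refine Finset.prod_congr rfl fun i _ => ?_
          rw [hfavg i, ENNReal.mul_rpow_of_nonneg _ _ (hr i).le]
      _ ≤ (∏ i, A i Q ^ r i) * (C0 * K ^ γ * ∏ i, μ i (E Q.1) ^ (r i / p i)) :=
          mul_le_mul_right key _
      _ = C0 * K ^ γ * ((∏ i, A i Q ^ r i) * ∏ i, μ i (E Q.1) ^ (r i / p i)) := by ring
      _ = _ := by
          rw [← Finset.prod_mul_distrib]
          congr 1
          refine Finset.prod_congr rfl fun i _ => ?_
          rw [ENNReal.mul_rpow_of_nonneg _ _ (div_pos (hr i) (hpp i)).le, ← ENNReal.rpow_mul,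
            mul_div_cancel₀ _ (hpp i).ne']
  have hHol : ∑' Q : S, ∏ i, (A i Q ^ p i * μ i (E Q.1)) ^ (r i / p i) ≤
      ∏ i, (∑' Q : S, A i Q ^ p i * μ i (E Q.1)) ^ (r i / p i) := by
    letI : MeasurableSpace S := ⊤
    have h := ENNReal.lintegral_prod_norm_pow_le (μ := (Measure.count : Measure S)) Finset.univ
      (f := fun i Q => A i Q ^ p i * μ i (E Q.1)) (fun i _ => measurable_from_top.aemeasurable)
      (p := fun i => r i / p i) hsum (fun i _ => (div_pos (hr i) (hpp i)).le)
    rw [lintegral_count' measurable_from_top] at h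
    refine h.trans (le_of_eq (Finset.prod_congr rfl fun i _ => ?_))
    rw [lintegral_count' measurable_from_top]
  calc ∑' Q : S, (∏ i, cubeAvg (fun x => f i x * w i x) Q.1 ^ (r i)) * volume Q.1.toSet
      ≤ ∑' Q : S, C0 * K ^ γ * ∏ i, (A i Q ^ p i * μ i (E Q.1)) ^ (r i / p i) :=
        ENNReal.tsum_le_tsum hpt
    _ = C0 * K ^ γ * ∑' Q : S, ∏ i, (A i Q ^ p i * μ i (E Q.1)) ^ (r i / p i) :=
        ENNReal.tsum_mul_left
    _ ≤ C0 * K ^ γ * ∏ i, (ENNReal.ofReal (p i / (p i - 1)) ^ p i *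
        ∫⁻ x, ENNReal.ofReal (f i x) ^ (p i) * ENNReal.ofReal (w i x)) ^ (r i / p i) := by
        refine mul_le_mul_right (hHol.trans (Finset.prod_le_prod' fun i _ => ?_)) _
        exact ENNReal.rpow_le_rpow (hmax i) (div_pos (hr i) (hpp i)).le
    _ = C0 * K ^ γ * ((∏ i, ENNReal.ofReal ((p i / (p i - 1)) ^ (r i))) *
        ∏ i, (∫⁻ x, ENNReal.ofReal (f i x) ^ (p i) * ENNReal.ofReal (w i x)) ^ (r i / p i)) := by
        rw [← Finset.prod_mul_distrib]
        congr 1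
        refine Finset.prod_congr rfl fun i _ => ?_
        have h1 : 0 < p i - 1 := by linarith [hp i]
        rw [ENNReal.mul_rpow_of_nonneg _ _ (div_pos (hr i) (hpp i)).le, ← ENNReal.rpow_mul,
          mul_div_cancel₀ _ (hpp i).ne', ENNReal.ofReal_rpow_of_pos (div_pos (hpp i) h1)]
    _ = _ := by ring
end
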